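/- Let p ≥ 1 be an integer, r > 0, and let u : ℝ^d → ℝ be an integrable function supported on the closed ball B_r = {|x| ≤ r} that is C^p-smooth with all partial derivatives of order p bounded by 1 in absolute value. Then its Fourier transform û(t) = ∫_{ℝ^d} e^{i⟨t,x⟩} u(x) dx satisfies ∫_{ℝ^d} |û(t)|² |t|^{2p} dt ≤ d^p · ω_d · (2πr)^d. -/

import Mathlib

open MeasureTheory
open scoped RealInnerProductSpace ENNReal NNReal

noncomputable section


/-- The list of coordinate directions encoded by a multi-index `α` on `ℝ^d`:
the direction `i` is repeated `α i` times, so the list has length `|α| = ∑ i, α i`. -/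
def multiIndexDirs {d : ℕ} (α : Fin d → ℕ) : List (Fin d) :=
  (List.finRange d).flatMap fun i => List.replicate (α i) i

/-- `D^α u (x)`: the partial derivative of `u` at `x` corresponding to the multi-index `α`
(of order `|α| = ∑ i, α i`), as an iterated derivative in the coordinate directions. -/
def mderiv {d : ℕ} (α : Fin d → ℕ) (u : EuclideanSpace ℝ (Fin d) → ℝ)
    (x : EuclideanSpace ℝ (Fin d)) : ℝ :=
  iteratedFDeriv ℝ (multiIndexDirs α).length u x
    (fun k => EuclideanSpace.single ((multiIndexDirs α).get k) 1)



open scoped FourierTransform SchwartzMap ContDiff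

lemma aux_planch {E : Type*} [NormedAddCommGroup E] [InnerProductSpace ℝ E]
    [FiniteDimensional ℝ E] [MeasurableSpace E] [BorelSpace E]
    (g : E → ℂ) (h1 : Integrable g) (h2 : MemLp g 2) :
    ∫⁻ s, ‖𝓕 g s‖ₑ ^ 2 = ∫⁻ x, ‖g x‖ₑ ^ 2 := by
  have hcont : Continuous (𝓕 g) :=
    VectorFourier.fourierIntegral_continuous Real.continuous_fourierChar
      continuous_inner h1
  have hae : ∀ᵐ x, (𝓕 (h2.toLp g) : Lp ℂ 2 (volume : Measure E)) x = 𝓕 g x := by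
    apply ae_eq_of_integral_contDiff_smul_eq
    · exact (Lp.memLp _).locallyIntegrable (by norm_num)
    · exact hcont.locallyIntegrable
    intro φ hφ hφc
    have hc : HasCompactSupport (Complex.ofRealCLM ∘ φ) := hφc.comp_left (map_zero _)
    have hd : ContDiff ℝ ∞ (Complex.ofRealCLM ∘ φ) := by fun_prop
    let ψ : 𝓢(E, ℂ) := hc.toSchwartzMap hd
    have hψ : ∀ x, ψ x = (φ x : ℂ) := fun x => rfl
    have e1 : ∫ x, φ x • (𝓕 (h2.toLp g) : Lp ℂ 2 (volume : Measure E)) x =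
        ((𝓕 (h2.toLp g) : Lp ℂ 2 (volume : Measure E)) : 𝓢'(E, ℂ)) ψ := by
      rw [Lp.toTemperedDistribution_apply]
      simp [hψ]
    rw [e1, ← Lp.fourier_toTemperedDistribution_eq, TemperedDistribution.fourier_apply,
      Lp.toTemperedDistribution_apply]
    have e2 : ∫ x, (𝓕 ψ) x • (h2.toLp g) x = ∫ x, (𝓕 ψ) x • g x := by
      apply integral_congr_ae
      filter_upwards [h2.coeFn_toLp] with x hx
      rw [hx]
    rw [e2]
    have := VectorFourier.integral_fourierIntegral_smul_eq_flip (μ := (volume : Measure E))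
      (ν := (volume : Measure E)) (L := innerₗ E) (f := ψ) (g := g)
      Real.continuous_fourierChar continuous_inner ψ.integrable h1
    rw [flip_innerₗ] at this
    rw [SchwartzMap.fourier_coe]
    refine this.trans ?_
    apply integral_congr_ae
    refine Filter.Eventually.of_forall fun x => ?_
    simp only [hψ]
    rw [Complex.real_smul]
    rfl
  have key : eLpNorm (𝓕 g) 2 = eLpNorm g 2 := by
    rw [← eLpNorm_congr_ae hae, ← eLpNorm_congr_ae h2.coeFn_toLp]
    have := Lp.norm_fourier_eq (h2.toLp g)
    rw [Lp.norm_def, Lp.norm_def, ENNReal.toReal_eq_toReal_iff'] at this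
    · exact this
    · exact Lp.eLpNorm_ne_top _
    · exact Lp.eLpNorm_ne_top _
  have k2 := congrArg (fun z => z ^ 2) key
  have conv : ∀ f : E → ℂ, eLpNorm f 2 ^ 2 = ∫⁻ x, ‖f x‖ₑ ^ 2 := by
    intro f
    have := eLpNorm_nnreal_pow_eq_lintegral (f := f) (μ := (volume : Measure E))
      (p := 2) (by norm_num)
    simpa using this
  rw [← conv, ← conv, key]

lemma aux_prod_dirs {d : ℕ} (α : Fin d → ℕ) (f : Fin d → ℝ) :
    ∏ k, f ((multiIndexDirs α).get k) = ∏ i, f i ^ α i := by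
  have : ∏ k, f ((multiIndexDirs α).get k) = ((multiIndexDirs α).map f).prod := by
    rw [← List.prod_ofFn]
    congr 1
    apply List.ext_get <;> simp
  rw [this, multiIndexDirs, List.map_flatMap, List.flatMap, List.prod_flatten, List.map_map,
    ← List.ofFn_eq_map, List.prod_ofFn]
  simp

lemma aux_len_dirs {d : ℕ} (α : Fin d → ℕ) : (multiIndexDirs α).length = ∑ i, α i := by
  simp [multiIndexDirs, List.length_flatMap, ← List.ofFn_eq_map, List.sum_ofFn]

lemma aux_key (d p : ℕ) (r : ℝ)
    (u : EuclideanSpace ℝ (Fin d) → ℝ)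
    (hsupp : Function.support u ⊆ Metric.closedBall 0 r)
    (hsm : ContDiff ℝ (p : ℕ∞) u) (α : Fin d → ℕ) (hα : ∑ i, α i = p)
    (hb : ∀ x, |mderiv α u x| ≤ 1) :
    ∫⁻ s : EuclideanSpace ℝ (Fin d), ‖𝓕 (fun x => (u x : ℂ)) s‖ₑ ^ 2 *
      ‖(2 * Real.pi) ^ p * ∏ i, s i ^ α i‖ₑ ^ 2 ≤
      volume (Metric.closedBall (0 : EuclideanSpace ℝ (Fin d)) r) := by
  have hts : tsupport u ⊆ Metric.closedBall 0 r := closure_minimal hsupp Metric.isClosed_closedBall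
  have hcs : HasCompactSupport u :=
    (isCompact_closedBall _ _).of_isClosed_subset (isClosed_tsupport _) hts
  set uc : EuclideanSpace ℝ (Fin d) → ℂ := fun x => (u x : ℂ) with huc
  have hucd : ContDiff ℝ (p : ℕ∞) uc := Complex.ofRealCLM.contDiff.comp hsm
  have hucs : HasCompactSupport uc := hcs.comp_left (g := fun x : ℝ => (x : ℂ)) (by simp)
  have hn : (multiIndexDirs α).length = p := (aux_len_dirs α).trans hα
  set n := (multiIndexDirs α).length with hndef
  set m : Fin n → EuclideanSpace ℝ (Fin d) :=
    fun k => EuclideanSpace.single ((multiIndexDirs α).get k) 1 with hm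
  have hcont : ∀ k : ℕ, (k : ℕ∞) ≤ p → Continuous (iteratedFDeriv ℝ k uc) := by
    intro k hk
    exact hucd.continuous_iteratedFDeriv (by exact_mod_cast hk)
  have hI : ∀ k : ℕ, (k : ℕ∞) ≤ p → Integrable (iteratedFDeriv ℝ k uc) := by
    intro k hk
    exact (hcont k hk).integrable_of_hasCompactSupport (hucs.iteratedFDeriv k)
  have hnp : (n : ℕ∞) ≤ p := by rw [hn]
  set g : EuclideanSpace ℝ (Fin d) → ℂ := fun x => iteratedFDeriv ℝ n uc x m with hg
  have hgval : ∀ x, g x = (mderiv α u x : ℂ) := by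
    intro x
    have h := Complex.ofRealCLM.iteratedFDeriv_comp_left (f := u) (x := x) (i := n)
      (n := (p : ℕ∞)) hsm.contDiffAt (by exact_mod_cast hnp)
    have h' : iteratedFDeriv ℝ n uc x = _ := h
    simp only [hg, h']
    rfl
  have hgc : Continuous g := (hcont n hnp).eval_const m
  have hgs : HasCompactSupport g :=
    (hucs.iteratedFDeriv (𝕜 := ℝ) n).comp_left
      (g := fun A : ContinuousMultilinearMap ℝ
        (fun _ : Fin n => EuclideanSpace ℝ (Fin d)) ℂ => A m) (by simp)
  have hF : ∀ s, ‖𝓕 uc s‖ₑ ^ 2 * ‖(2 * Real.pi) ^ p * ∏ i, s i ^ α i‖ₑ ^ 2 = ‖𝓕 g s‖ₑ ^ 2 := by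
    intro s
    have h1 := congrFun (Real.fourier_iteratedFDeriv hucd hI hnp) s
    have h2 := congrArg (fun A => A m) h1
    rw [Real.fourier_continuousMultilinearMap_apply (hI n hnp)] at h2
    simp only [VectorFourier.fourierPowSMulRight_apply] at h2
    have h3 : ∏ k, (-innerSL ℝ) s (m k) = (-1) ^ n * ∏ i, s i ^ α i := by
      rw [← aux_prod_dirs]
      have : ∀ k, (-innerSL ℝ) s (m k) = - s ((multiIndexDirs α).get k) := by
        intro k
        simp [hm, EuclideanSpace.inner_single_right]
      simp only [this]
      rw [Finset.prod_neg, Finset.card_univ, Fintype.card_fin]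
    rw [h3] at h2
    rw [← mul_pow, hg, h2, enorm_smul, enorm_smul, enorm_mul, enorm_mul, hn]
    have e1 : ‖(-(2 * (Real.pi : ℂ) * Complex.I)) ^ p‖ₑ = ‖(2 * Real.pi) ^ p‖ₑ := by
      rw [← ofReal_norm, ← ofReal_norm]
      simp
    have e2 : ‖((-1 : ℝ)) ^ p‖ₑ = 1 := by
      rw [← ofReal_norm]
      simp
    rw [e1, e2]
    ring
  simp_rw [hF]
  rw [aux_planch g (hgc.integrable_of_hasCompactSupport hgs)
    (hgc.memLp_of_hasCompactSupport hgs)]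
  calc ∫⁻ x, ‖g x‖ₑ ^ 2 ≤ ∫⁻ x, (Metric.closedBall (0 : EuclideanSpace ℝ (Fin d)) r).indicator
        (fun _ => 1) x := by
        apply lintegral_mono
        intro x
        by_cases hx : x ∈ Metric.closedBall (0 : EuclideanSpace ℝ (Fin d)) r
        · simp only [hx, Set.indicator_of_mem]
          rw [hgval]
          apply pow_le_one₀ (by simp)
          have : ‖((mderiv α u x : ℝ) : ℂ)‖ ≤ 1 := by simpa using hb x
          rw [← ofReal_norm]
          simpa using this
        · have : iteratedFDeriv ℝ n u x = 0 := by
            by_contra h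
            exact hx (hts (support_iteratedFDeriv_subset n h))
          have h0 : mderiv α u x = 0 := by
            change iteratedFDeriv ℝ n u x m = 0
            rw [this]; rfl
          simp [hgval, h0]
    _ = _ := by
        rw [lintegral_indicator Metric.isClosed_closedBall.measurableSet]; simp

/-- **Lemma 6.1.** If `u : ℝ^d → ℝ` is integrable, supported on the closed ball of radius
`r`, and `C^p`-smooth with all partial derivatives of order `p` bounded by `1`, then its
Fourier transform `û(t) = ∫ e^{i⟪t,x⟫} u(x) dx` satisfies
`∫ |û(t)|² |t|^{2p} dt ≤ d^p ω_d (2πr)^d`. -/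
theorem fourier_weighted_l2_bound (d p : ℕ) (hp : 1 ≤ p) (r : ℝ) (hr : 0 < r)
    (u : EuclideanSpace ℝ (Fin d) → ℝ) (hint : Integrable u volume)
    (hsupp : Function.support u ⊆ Metric.closedBall 0 r)
    (hsm : ContDiff ℝ (p : ℕ∞) u)
    (hb : ∀ α : Fin d → ℕ, (∑ i, α i) = p → ∀ x, |mderiv α u x| ≤ 1) :
    ∫⁻ t : EuclideanSpace ℝ (Fin d),
        (‖∫ x : EuclideanSpace ℝ (Fin d),
            Complex.exp (Complex.I * (⟪t, x⟫ : ℝ)) * (u x : ℂ) ∂volume‖₊ : ℝ≥0∞) ^ 2 *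
          (‖t‖₊ : ℝ≥0∞) ^ (2 * p) ∂volume ≤
      ENNReal.ofReal ((d : ℝ) ^ p *
        (volume (Metric.closedBall (0 : EuclideanSpace ℝ (Fin d)) 1)).toReal *
        (2 * Real.pi * r) ^ d) := by
  have hint' := hint
  set uc : EuclideanSpace ℝ (Fin d) → ℂ := fun x => (u x : ℂ) with huc
  have huci : Integrable uc := hint'.ofReal
  have hpi : 0 < 2 * Real.pi := by positivity
  set c : ℝ := -(2 * Real.pi)⁻¹ with hc
  have hc0 : c ≠ 0 := by rw [hc]; exact neg_ne_zero.mpr (inv_ne_zero hpi.ne')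
  have hFc : Continuous (𝓕 uc) :=
    VectorFourier.fourierIntegral_continuous Real.continuous_fourierChar
      continuous_inner huci
  set H : EuclideanSpace ℝ (Fin d) → ℝ≥0∞ :=
    fun s => ‖𝓕 uc s‖ₑ ^ 2 * ‖(2 * Real.pi) ^ p * ‖s‖ ^ p‖ₑ ^ 2 with hH
  have hHm : Measurable H := by
    apply Measurable.fun_mul
    · exact (hFc.measurable.enorm).pow_const 2
    · have : Continuous fun s : EuclideanSpace ℝ (Fin d) => (2 * Real.pi) ^ p * ‖s‖ ^ p := by
        fun_prop
      exact (this.measurable.enorm).pow_const 2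
  have hG : ∀ t : EuclideanSpace ℝ (Fin d),
      (‖∫ x : EuclideanSpace ℝ (Fin d),
            Complex.exp (Complex.I * (⟪t, x⟫ : ℝ)) * (u x : ℂ) ∂volume‖₊ : ℝ≥0∞) ^ 2 *
          (‖t‖₊ : ℝ≥0∞) ^ (2 * p) = H (c • t) := by
    intro t
    have e1 : ∫ x : EuclideanSpace ℝ (Fin d),
            Complex.exp (Complex.I * (⟪t, x⟫ : ℝ)) * (u x : ℂ) ∂volume = 𝓕 uc (c • t) := by
      rw [Real.fourier_eq']
      apply integral_congr_ae
      refine Filter.Eventually.of_forall fun x => ?_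
      simp only [smul_eq_mul, huc]
      congr 2
      rw [inner_smul_right, real_inner_comm, hc]
      push_cast
      have : (Real.pi : ℂ) ≠ 0 := by exact_mod_cast Real.pi_ne_zero
      field_simp
    have e2 : ‖(2 * Real.pi) ^ p * ‖c • t‖ ^ p‖ₑ = (‖t‖₊ : ℝ≥0∞) ^ p := by
      have : (2 * Real.pi) ^ p * ‖c • t‖ ^ p = ‖t‖ ^ p := by
        rw [← mul_pow, norm_smul, hc, norm_neg, norm_inv, Real.norm_of_nonneg hpi.le,
          mul_inv_cancel_left₀ hpi.ne']
      rw [this, enorm_pow, enorm_norm]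
      rfl
    rw [e1, hH]
    simp only
    rw [e2, ← pow_mul, mul_comm p 2]
    rfl
  have hsum : ∀ s, H s = ∑ w : Fin p → Fin d, ‖𝓕 uc s‖ₑ ^ 2 *
      ‖(2 * Real.pi) ^ p * ∏ i, s i ^ (Finset.univ.filter (fun k => w k = i)).card‖ₑ ^ 2 := by
    intro s
    rw [← Finset.mul_sum]
    simp only [hH]
    congr 1
    have hsq : ∀ x : ℝ, ‖x‖ₑ ^ 2 = ENNReal.ofReal (x ^ 2) := by
      intro x
      rw [← ofReal_norm, ← ENNReal.ofReal_pow (norm_nonneg _), Real.norm_eq_abs, sq_abs]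
    simp only [hsq]
    rw [← ENNReal.ofReal_sum_of_nonneg (fun _ _ => sq_nonneg _)]
    congr 1
    simp only [mul_pow]
    rw [← Finset.mul_sum]
    congr 1
    rw [← pow_mul, mul_comm p 2, pow_mul, EuclideanSpace.real_norm_sq_eq, Finset.sum_pow']
    simp only [Fintype.piFinset_univ]
    refine Finset.sum_congr rfl fun w _ => ?_
    rw [Finset.prod_pow]
    congr 1
    rw [← Finset.prod_fiberwise Finset.univ w]
    refine Finset.prod_congr rfl fun i _ => ?_
    apply Finset.prod_eq_pow_card
    intro k hk
    rw [(Finset.mem_filter.mp hk).2]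
  simp_rw [hG]
  rw [← lintegral_map (μ := volume) (f := H) (g := fun t => c • t) hHm (measurable_const_smul c),
    Measure.map_addHaar_smul _ hc0, lintegral_smul_measure]
  have hbound : ∫⁻ s, H s ≤
      (d : ℝ≥0∞) ^ p * volume (Metric.closedBall (0 : EuclideanSpace ℝ (Fin d)) r) := by
    simp_rw [hsum]
    rw [lintegral_finsetSum]
    · calc _ ≤ ∑ w : Fin p → Fin d,
            volume (Metric.closedBall (0 : EuclideanSpace ℝ (Fin d)) r) := by
            refine Finset.sum_le_sum fun w _ => ?_
            have hα : ∑ i, (Finset.univ.filter (fun k => w k = i)).card = p := by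
              rw [← Finset.card_eq_sum_card_fiberwise (fun _ _ => Finset.mem_univ _)]
              simp
            exact aux_key d p r u hsupp hsm _ hα (hb _ hα)
        _ = _ := by simp
    · intro w _
      apply Measurable.fun_mul
      · exact (hFc.measurable.enorm).pow_const 2
      · have : Continuous fun s : EuclideanSpace ℝ (Fin d) => (2 * Real.pi) ^ p *
            ∏ i, s i ^ (Finset.univ.filter (fun k => w k = i)).card := by
          fun_prop
        exact (this.measurable.enorm).pow_const 2
  have hball := Measure.addHaar_closedBall' (volume : Measure (EuclideanSpace ℝ (Fin d))) 0 hr.le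
  rw [finrank_euclideanSpace_fin] at hball ⊢
  rw [hball] at hbound
  have hcc : |(c ^ d)⁻¹| = (2 * Real.pi) ^ d := by
    rw [abs_inv, abs_pow, hc, abs_neg, abs_inv, abs_of_pos hpi, inv_pow, inv_inv]
  rw [hcc, smul_eq_mul]
  refine (mul_le_mul_right hbound _).trans (le_of_eq ?_)
  have hfin : volume (Metric.closedBall (0 : EuclideanSpace ℝ (Fin d)) 1) ≠ ⊤ :=
    measure_closedBall_lt_top.ne
  rw [ENNReal.ofReal_mul (by positivity), ENNReal.ofReal_mul (by positivity),
    ENNReal.ofReal_toReal hfin, mul_pow (2 * Real.pi) r, ENNReal.ofReal_mul (by positivity),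
    ENNReal.ofReal_pow (by positivity : (0 : ℝ) ≤ d), ENNReal.ofReal_natCast]
  ring
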